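/- For every n ≥ 1 there are, up to isomorphism, exactly 2n abelian groups that are generated by an invertible n-state Mealy automaton over the binary alphabet {0,1}. -/

import Mathlib

/-- The automorphism group of the rooted binary tree `{0,1}*`, realized as the subgroup of
permutations of `List Bool` (finite binary words, with `[]` the root and `w` adjacent to
`w ++ [x]`) consisting of those permutations that fix the root and map children of a vertex
to children of its image (equivalently, bijections fixing the root and preserving adjacency). -/
def binTreeAut : Subgroup (Equiv.Perm (List Bool)) where
  carrier := {f | f [] = [] ∧ ∀ (w : List Bool) (x : Bool), ∃ y : Bool, f (w ++ [x]) = f w ++ [y]}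
  one_mem' := ⟨rfl, fun w x => ⟨x, rfl⟩⟩
  mul_mem' := by
    rintro f g ⟨hf0, hf⟩ ⟨hg0, hg⟩
    refine ⟨by simp [Equiv.Perm.mul_apply, hg0, hf0], ?_⟩
    intro w x
    obtain ⟨y, hy⟩ := hg w x
    obtain ⟨z, hz⟩ := hf (g w) y
    exact ⟨z, by simp [Equiv.Perm.mul_apply, hy, hz]⟩
  inv_mem' := by
    rintro f ⟨hf0, hf⟩
    constructor
    · have h : f⁻¹ (f []) = [] := Equiv.symm_apply_apply f []
      rwa [hf0] at h
    · intro w x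
      have hfv : f (f⁻¹ (w ++ [x])) = w ++ [x] := Equiv.apply_symm_apply f (w ++ [x])
      rcases List.eq_nil_or_concat (f⁻¹ (w ++ [x])) with hnil | ⟨w', x', hcons⟩
      · rw [hnil, hf0] at hfv
        exact absurd hfv.symm (by simp)
      · rw [hcons, List.concat_eq_append] at hfv
        obtain ⟨y, hy⟩ := hf w' x'
        rw [hy] at hfv
        have h2 := List.append_inj' hfv rfl
        have hw' : w' = f⁻¹ w := by
          rw [← h2.1]; exact (Equiv.symm_apply_apply f w').symm
        refine ⟨x', ?_⟩
        rw [hcons, List.concat_eq_append, hw']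

/-- A time-varying automaton over the binary alphabet `{0,1}` (encoded as `Bool`) with state
set `Q`: a sequence of transition functions and a sequence of output functions.  (Indexing of
the transitions starts here at `0`, corresponding to the first transition.) -/
structure TVAutomaton (Q : Type*) where
  phi : ℕ → Q → Bool → Q
  psi : ℕ → Q → Bool → Bool

namespace TVAutomaton

variable {Q : Type*}

/-- An automaton is invertible if all labelings `x ↦ psi i q x` are bijections. -/
def Invertible (A : TVAutomaton Q) : Prop := ∀ i q, Function.Bijective (A.psi i q)

/-- A Mealy automaton is a time-varying automaton whose sequences of transition and output
functions are constant. -/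
def IsMealy (A : TVAutomaton Q) : Prop := ∀ i, A.phi i = A.phi 0 ∧ A.psi i = A.psi 0

/-- The automaton transformation of the state `q` in its `i`-th transition. -/
def act (A : TVAutomaton Q) : ℕ → Q → List Bool → List Bool
  | _, _, [] => []
  | i, q, x :: w => A.psi i q x :: A.act (i + 1) (A.phi i q x) w

/-- The inverse automaton transformation (for invertible automata). -/
noncomputable def invAct (A : TVAutomaton Q) : ℕ → Q → List Bool → List Bool
  | _, _, [] => []
  | i, q, y :: u =>
    Function.invFun (A.psi i q) y ::
      A.invAct (i + 1) (A.phi i q (Function.invFun (A.psi i q) y)) u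

theorem act_invAct (A : TVAutomaton Q) (h : A.Invertible) :
    ∀ (u : List Bool) (i : ℕ) (q : Q), A.act i q (A.invAct i q u) = u := by
  intro u
  induction u with
  | nil => intro i q; rfl
  | cons y u ih =>
    intro i q
    rw [invAct, act, ih]
    congr 1
    exact Function.rightInverse_invFun (h i q).2 y

theorem invAct_act (A : TVAutomaton Q) (h : A.Invertible) :
    ∀ (w : List Bool) (i : ℕ) (q : Q), A.invAct i q (A.act i q w) = w := by
  intro w
  induction w with
  | nil => intro i q; rfl
  | cons x w ih =>
    intro i q
    have hx : Function.invFun (A.psi i q) (A.psi i q x) = x :=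
      Function.leftInverse_invFun (h i q).1 x
    rw [act, invAct, hx, ih]

/-- The automaton transformation of the state `q` in its `i`-th transition, as a
permutation of the set of binary words. -/
noncomputable def toPerm (A : TVAutomaton Q) (h : A.Invertible) (i : ℕ) (q : Q) :
    Equiv.Perm (List Bool) where
  toFun := A.act i q
  invFun := A.invAct i q
  left_inv := fun w => A.invAct_act h w i q
  right_inv := fun u => A.act_invAct h u i q

theorem act_concat (A : TVAutomaton Q) :
    ∀ (w : List Bool) (i : ℕ) (q : Q) (x : Bool),
      ∃ y, A.act i q (w ++ [x]) = A.act i q w ++ [y] := by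
  intro w
  induction w with
  | nil => intro i q x; exact ⟨A.psi i q x, rfl⟩
  | cons a w ih =>
    intro i q x
    obtain ⟨y, hy⟩ := ih (i + 1) (A.phi i q a) x
    refine ⟨y, ?_⟩
    show A.psi i q a :: A.act (i + 1) (A.phi i q a) (w ++ [x]) = _
    rw [hy]; rfl

/-- The automaton transformation of the state `q` in its `i`-th transition, as an
automorphism of the rooted binary tree. -/
noncomputable def toAut (A : TVAutomaton Q) (h : A.Invertible) (i : ℕ) (q : Q) :
    ↥binTreeAut :=
  ⟨A.toPerm h i q, ⟨rfl, fun w x => A.act_concat w i q x⟩⟩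

/-- The group `G(A)` generated by an invertible time-varying automaton `A`: the subgroup of
`Aut({0,1}*)` generated by the transformations of all states of `A` in their first
transition. -/
noncomputable def genGroup (A : TVAutomaton Q) (h : A.Invertible) : Subgroup ↥binTreeAut :=
  Subgroup.closure (Set.range fun q => A.toAut h 0 q)

end TVAutomaton

/-- A tree automorphism belongs to the first level stabilizer: it fixes both one-letter
words. -/
def FixesLevelOne (g : ↥binTreeAut) : Prop :=
  (g : Equiv.Perm (List Bool)) [false] = [false] ∧ (g : Equiv.Perm (List Bool)) [true] = [true]

/-- Compatible data of root activities and first-level sections for a faithful action of a group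
on binary words. -/
structure SelfSimilarAction (P : Type*) [Group P] where
  toPerm : P →* Equiv.Perm (List Bool)
  injective : Function.Injective toPerm
  active : P → Bool
  sec : P → Bool → P
  apply_nil : ∀ g, toPerm g [] = []
  apply_cons : ∀ g x w, toPerm g (x :: w) = (x ^^ active g) :: toPerm (sec g x) w

namespace SelfSimilarAction

section Group

variable {P : Type*} [Group P] (S : SelfSimilarAction P)

theorem active_and_sec_eq {g : P} {a : Bool} {s : Bool → P}
    (h : ∀ x w, S.toPerm g (x :: w) = (x ^^ a) :: S.toPerm (s x) w) :
    S.active g = a ∧ ∀ x, S.sec g x = s x := by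
  have key : ∀ x w, (x ^^ S.active g) = (x ^^ a) ∧
      S.toPerm (S.sec g x) w = S.toPerm (s x) w := by
    intro x w
    have := h x w
    rw [S.apply_cons] at this
    exact List.cons.inj this
  refine ⟨by simpa using (key false []).1, fun x => S.injective (Equiv.ext fun w => (key x w).2)⟩

theorem mul_spec (g h : P) : S.active (g * h) = (S.active g ^^ S.active h) ∧
    ∀ x, S.sec (g * h) x = S.sec g (x ^^ S.active h) * S.sec h x := by
  apply S.active_and_sec_eq
  intro x w
  rw [map_mul, Equiv.Perm.mul_apply, S.apply_cons h, S.apply_cons g, map_mul,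
    Equiv.Perm.mul_apply, Bool.xor_assoc, Bool.xor_comm (S.active h)]

theorem active_mul (g h : P) : S.active (g * h) = (S.active g ^^ S.active h) :=
  (S.mul_spec g h).1

theorem sec_mul (g h : P) (x : Bool) :
    S.sec (g * h) x = S.sec g (x ^^ S.active h) * S.sec h x :=
  (S.mul_spec g h).2 x

theorem one_spec : S.active 1 = false ∧ ∀ x, S.sec 1 x = 1 :=
  S.active_and_sec_eq fun x w => by simp

theorem active_mul_self (g : P) : S.active (g * g) = false := by simp [S.active_mul]

/-- A set of inactive elements closed under sections contains at most the identity. -/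
theorem eq_one_of_mem (T : Set P) (h : ∀ g ∈ T, S.active g = false ∧ ∀ x, S.sec g x ∈ T)
    {g : P} (hg : g ∈ T) : g = 1 := by
  apply S.injective
  ext1 w
  induction w generalizing g with
  | nil => simp [S.apply_nil]
  | cons x w ih =>
    rw [S.apply_cons, (h g hg).1, ih ((h g hg).2 x)]
    simp

theorem pow_spec {g : P} (hg : S.active g = false) (m : ℕ) :
    S.active (g ^ m) = false ∧ ∀ x, S.sec (g ^ m) x = S.sec g x ^ m := by
  induction m with
  | zero => simpa using S.one_spec
  | succ m ih =>
    refine ⟨by rw [pow_succ, S.active_mul, ih.1, hg]; rfl, fun x => ?_⟩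
    rw [pow_succ, S.sec_mul, hg, Bool.xor_false, ih.2, pow_succ]

theorem active_pow_two_mul_add_one (g : P) (m : ℕ) :
    S.active (g ^ (2 * m + 1)) = S.active g := by
  rw [pow_succ, pow_mul, S.active_mul,
    (S.pow_spec (by rw [pow_two]; exact S.active_mul_self g) m).1, Bool.false_xor]

end Group

variable {P : Type*} [CommGroup P] (S : SelfSimilarAction P)

theorem sec_eq_sec {g : P} (hg : S.active g = false) (x y : Bool) : S.sec g x = S.sec g y := by
  suffices h : S.sec g false = S.sec g true by cases x <;> cases y <;> simp [h]
  by_cases hb : ∃ b, S.active b = true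
  · obtain ⟨b, hb⟩ := hb
    have h := S.sec_mul g b false
    rw [mul_comm g b, S.sec_mul, hg, hb, Bool.xor_false, mul_comm] at h
    exact mul_right_cancel h
  · have hone : ∀ k : P, k = 1 := fun k =>
      S.eq_one_of_mem Set.univ (fun c _ => ⟨by simpa using fun hc => hb ⟨c, hc⟩, by simp⟩)
        (Set.mem_univ k)
    rw [hone (S.sec g false), hone (S.sec g true)]

theorem mul_self_eq_one_of_active {t : P} (ht : S.active t = true) (ht2 : t * t = 1) (g : P) :
    g * g = 1 := by
  have inactive : ∀ k : P, ∃ c, S.active c = false ∧ c * c = k * k := by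
    intro k
    cases hk : S.active k with
    | false => exact ⟨k, hk, rfl⟩
    | true =>
      refine ⟨k * t, by simp [S.active_mul, hk, ht], ?_⟩
      rw [mul_mul_mul_comm, ht2, mul_one]
  refine S.eq_one_of_mem {k | ∃ c, k = c * c} ?_ ⟨g, rfl⟩
  rintro _ ⟨k, rfl⟩
  obtain ⟨c, hc, hck⟩ := inactive k
  refine ⟨S.active_mul_self k, fun x => ⟨S.sec c x, ?_⟩⟩
  rw [← hck, S.sec_mul, hc, Bool.xor_false]

/-- An abelian self-similar group over the binary alphabet either has exponent two or is
torsion-free. -/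
theorem exponent_two_or_torsionFree (S : SelfSimilarAction P) :
    (∀ g : P, g * g = 1) ∨ ∀ (p : ℕ), p.Prime → ∀ g : P, g ^ p = 1 → g = 1 := by
  by_contra! hcon
  obtain ⟨⟨g₀, hg₀⟩, p, hp, g, hgp, hg⟩ := hcon
  by_cases hact : ∀ k : P, k ^ p = 1 → S.active k = false
  · refine hg (S.eq_one_of_mem {k | k ^ p = 1} (fun k hk => ⟨hact k hk, fun x => ?_⟩) hgp)
    have hx := (S.pow_spec (hact k hk) p).2 x
    rw [show k ^ p = 1 from hk, S.one_spec.2] at hx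
    exact hx.symm
  · push Not at hact
    obtain ⟨t, htp, ht⟩ := hact
    have ht : S.active t = true := by simpa using ht
    rcases hp.eq_two_or_odd' with rfl | ⟨m, rfl⟩
    · exact hg₀ (S.mul_self_eq_one_of_active ht (by rw [← pow_two, htp]) g₀)
    · have := S.active_pow_two_mul_add_one t m
      rw [htp, S.one_spec.1, ht] at this
      exact Bool.false_ne_true this

/-- The endomorphism sending `g` to the section of `g ^ 2`. -/
def secSq : P →* P where
  toFun g := S.sec (g * g) false
  map_one' := by rw [mul_one, S.one_spec.2]
  map_mul' g h := by
    rw [mul_mul_mul_comm, S.sec_mul, S.active_mul_self, Bool.xor_false]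

theorem mul_self_eq_one_of_secSq_eq {g : P} (hg : S.secSq g = g * g) : g * g = 1 := by
  refine S.eq_one_of_mem {g * g} ?_ rfl
  rintro _ rfl
  refine ⟨S.active_mul_self g, fun x => ?_⟩
  rw [S.sec_eq_sec (S.active_mul_self g) x false]
  exact hg

/-- States whose sections are again states satisfy a nontrivial relation in a torsion-free
abelian self-similar group. -/
theorem exists_relation {n : ℕ} (hn : 1 ≤ n) (q : Fin n → P) (φ : Fin n → Bool → Fin n)
    (hφ : ∀ i x, S.sec (q i) x = q (φ i x)) (htf : ∀ g : P, g * g = 1 → g = 1) :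
    ∃ v : Fin n → ℤ, v ≠ 0 ∧
      Fintype.linearCombination ℤ (fun i => Additive.ofMul (q i)) v = 0 := by
  let N : Matrix (Fin n) (Fin n) ℤ := Matrix.of fun j i =>
    (Pi.single (φ i (S.active (q i))) 1 + Pi.single (φ i false) 1 : Fin n → ℤ) j
  let M : Matrix (Fin n) (Fin n) ℤ := N - (2 : ℤ) • 1
  have hdet : M.det = 0 := by
    rw [← Matrix.exists_vecMul_eq_zero_iff]
    refine ⟨fun _ => 1, fun h => one_ne_zero (congrFun h ⟨0, hn⟩), ?_⟩
    ext i
    have hentry : ∀ j, M j i = (Pi.single (φ i (S.active (q i))) 1 : Fin n → ℤ) j +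
        (Pi.single (φ i false) 1 : Fin n → ℤ) j - 2 * (Pi.single i 1 : Fin n → ℤ) j := fun j => by
      simp only [M, N, Matrix.sub_apply, Matrix.smul_apply, Matrix.of_apply, Pi.add_apply,
        Matrix.one_apply, Pi.single_apply, smul_eq_mul]
    simp [Matrix.vecMul, dotProduct, hentry, Finset.sum_add_distrib, ← Finset.mul_sum]
  obtain ⟨v, hv, hMv⟩ := Matrix.exists_mulVec_eq_zero_iff.mpr hdet
  refine ⟨v, hv, ?_⟩
  set π := Fintype.linearCombination ℤ (fun i => Additive.ofMul (q i)) with hπ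
  let θ : Additive P →ₗ[ℤ] Additive P := (MonoidHom.toAdditive S.secSq).toIntLinearMap
  have hcomp : π ∘ₗ Matrix.mulVecLin N = θ ∘ₗ π := by
    refine LinearMap.pi_ext' fun i => LinearMap.ext_ring ?_
    have hcol : N.mulVec (Pi.single i 1) =
        Pi.single (φ i (S.active (q i))) 1 + Pi.single (φ i false) 1 := by
      ext j; simp [N]
    simp only [LinearMap.comp_apply, LinearMap.single_apply, Matrix.mulVecLin_apply, hcol,
      map_add, hπ, Fintype.linearCombination_apply_single, one_smul]
    change _ = Additive.ofMul (S.sec (q i * q i) false)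
    rw [S.sec_mul, hφ, hφ, Bool.false_xor, ofMul_mul]
  have hNv : N.mulVec v = (2 : ℤ) • v := by
    rw [Matrix.sub_mulVec, Matrix.smul_mulVec, Matrix.one_mulVec, sub_eq_zero] at hMv
    exact hMv
  have hθ : θ (π v) = π v + π v := by
    have := LinearMap.congr_fun hcomp v
    simp only [LinearMap.comp_apply, Matrix.mulVecLin_apply, hNv, two_smul, map_add] at this
    exact this.symm
  exact htf _ (S.mul_self_eq_one_of_secSq_eq (g := (π v).toMul) hθ)

theorem nonempty_mulEquiv {n : ℕ} (hn : 1 ≤ n) (q : Fin n → P) (φ : Fin n → Bool → Fin n)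
    (hφ : ∀ i x, S.sec (q i) x = q (φ i x)) (hq : Subgroup.closure (Set.range q) = ⊤) :
    (∃ k ≤ n, Nonempty (P ≃* Multiplicative (Fin k → ZMod 2))) ∨
      ∃ k < n, Nonempty (P ≃* Multiplicative (Fin k → ℤ)) := by
  have hspan : Submodule.span ℤ (Set.range fun i => Additive.ofMul (q i)) = ⊤ := by
    rw [← Submodule.toAddSubgroup_inj, Submodule.span_int_eq_addSubgroupClosure]
    have h := Subgroup.toAddSubgroup_closure (Set.range q)
    rw [hq] at h
    exact h.symm
  have hsurj : Function.Surjective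
      (Fintype.linearCombination ℤ (fun i => Additive.ofMul (q i))) := by
    rw [← LinearMap.range_eq_top, Fintype.range_linearCombination, hspan]
  rcases S.exponent_two_or_torsionFree with h2 | htf
  · left
    let _ : Module (ZMod 2) (Additive P) := AddCommGroup.zmodModule (n := 2) fun x => by
      rw [two_nsmul]; exact h2 x.toMul
    have hspan2 : Submodule.span (ZMod 2) (Set.range fun i => Additive.ofMul (q i)) = ⊤ := by
      rw [eq_top_iff]
      rintro x -
      have hx : x ∈ Submodule.span ℤ (Set.range fun i => Additive.ofMul (q i)) := by
        rw [hspan]; trivial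
      exact Submodule.span_subset_span ℤ (ZMod 2) _ hx
    have : Module.Finite (ZMod 2) (Additive P) :=
      ⟨⟨(Set.finite_range _).toFinset, by rw [Set.Finite.coe_toFinset, hspan2]⟩⟩
    refine ⟨Module.finrank (ZMod 2) (Additive P), ?_, ⟨AddEquiv.toMultiplicativeRight
      (Module.finBasis (ZMod 2) (Additive P)).equivFun.toAddEquiv⟩⟩
    have := finrank_range_le_card (R := ZMod 2) (fun i => Additive.ofMul (q i))
    rw [Set.finrank, hspan2, finrank_top, Fintype.card_fin] at this
    exact this
  · right
    have : Module.Finite ℤ (Additive P) := Module.Finite.of_surjective _ hsurj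
    have htf' : ∀ m : ℕ, m ≠ 0 → ∀ g : P, g ^ m = 1 → g = 1 := by
      intro m
      induction m using induction_on_primes with
      | zero => simp
      | one => simp
      | prime_mul p m hp ih =>
        intro hm g hg
        exact htf p hp g (ih (by simp_all) _ (by rw [← pow_mul, hg]))
    have : IsMulTorsionFree P := ⟨fun m hm g k hgk => by
      have hone : (g / k) ^ m = 1 := by
        rw [div_pow, div_eq_one]
        exact hgk
      exact div_eq_one.mp (htf' m hm _ hone)⟩
    refine ⟨Module.finrank ℤ (Additive P), ?_, ⟨AddEquiv.toMultiplicativeRight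
      (Module.finBasis ℤ (Additive P)).equivFun.toAddEquiv⟩⟩
    obtain ⟨v, hv, hv0⟩ := S.exists_relation hn q φ hφ fun g hg =>
      htf 2 Nat.prime_two g (by rw [pow_two, hg])
    have hle := LinearMap.finrank_le_finrank_of_surjective hsurj
    rw [Module.finrank_fin_fun] at hle
    refine lt_of_le_of_ne hle fun heq => hv ?_
    let b := (Module.finBasisOfFinrankEq ℤ (Additive P) heq).equivFun
    have hinj := OrzechProperty.injective_of_surjective_endomorphism
      (b.toLinearMap ∘ₗ Fintype.linearCombination ℤ (fun i => Additive.ofMul (q i)))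
      (b.surjective.comp hsurj)
    exact hinj (by simp only [LinearMap.comp_apply, hv0, map_zero])

end SelfSimilarAction

/-- Arithmetic data of an adding machine with values in `M`. -/
structure CarryRule (M : Type*) [AddCommGroup M] where
  one : M
  parity : M → Bool
  carry : M → Bool → M
  size : M → ℕ
  parity_add : ∀ u v, parity (u + v) = (parity u ^^ parity v)
  carry_add : ∀ u v x, carry (u + v) x = carry u (x ^^ parity v) + carry v x
  descent : ∀ u, parity u = false → u ≠ 0 → carry u false ≠ 0 ∧ size (carry u false) < size u
  exists_zsmul_one : ∀ u, ∃ z : ℤ, z • one = u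

/-- Binary addition of integers with carry. -/
def intCarryRule : CarryRule ℤ where
  one := 1
  parity u := decide (u % 2 = 1)
  carry u x := (u + x.toInt) / 2
  size := Int.natAbs
  parity_add u v := by
    by_cases hu : u % 2 = 1 <;> by_cases hv : v % 2 = 1 <;> simp [hu, hv] <;> omega
  carry_add u v x := by
    by_cases hv : v % 2 = 1 <;> cases x <;> simp [hv] <;> omega
  descent u hu hu0 := by
    simp at hu ⊢
    omega
  exists_zsmul_one u := ⟨u, by simp⟩

/-- Addition modulo two in which every value is carried unchanged. -/
def zmodTwoCarryRule : CarryRule (ZMod 2) where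
  one := 1
  parity u := decide (u = 1)
  carry u _ := u
  size _ := 0
  parity_add := by decide
  carry_add u v x := rfl
  descent := by decide
  exists_zsmul_one u := ⟨u.val, by simp⟩

namespace CarryRule

variable {M : Type*} [AddCommGroup M] (R : CarryRule M)

theorem parity_zero : R.parity 0 = false := by
  have h := R.parity_add 0 0
  rwa [add_zero, Bool.xor_self] at h

theorem carry_zero (x : Bool) : R.carry 0 x = 0 := by
  have h := R.carry_add 0 0 x
  rwa [add_zero, R.parity_zero, Bool.xor_false, left_eq_add] at h

variable {k : ℕ} [NeZero k]

/-- Process the head of the register on the input letter `x`, then rotate the register. -/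
def step (v : Fin k → M) (x : Bool) : Fin k → M :=
  fun i => Function.update v 0 (R.carry (v 0) x) (i + 1)

theorem step_zero (x : Bool) : R.step (0 : Fin k → M) x = 0 := by
  ext i
  simp [step, R.carry_zero, Function.update_apply]

theorem step_add (u v : Fin k → M) (x : Bool) :
    R.step (u + v) x = R.step u (x ^^ R.parity (v 0)) + R.step v x := by
  ext i
  by_cases hi : i + 1 = 0 <;> simp [step, hi, R.carry_add]

theorem step_single_zero (m : M) (x : Bool) :
    R.step (Pi.single (0 : Fin k) m) x = Pi.single (-1) (R.carry m x) := by
  ext i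
  by_cases hi : i + 1 = 0
  · obtain rfl : i = -1 := eq_neg_of_add_eq_zero_left hi
    simp [step]
  · have : i ≠ -1 := fun h => hi (by simp [h])
    simp [step, hi, this]

theorem step_single {j : Fin k} (hj : j ≠ 0) (m : M) (x : Bool) :
    R.step (Pi.single j m) x = Pi.single (j - 1) m := by
  ext i
  by_cases hi : i + 1 = 0
  · have : i ≠ j - 1 := fun h => hj (by rw [← hi, h, sub_add_cancel])
    simp [step, hi, this, hj.symm, R.carry_zero]
  · simp [step, hi, Pi.single_apply, eq_sub_iff_add_eq]

/-- The action on binary words of a register of `k` interleaved adding machines. -/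
def run : (Fin k → M) → List Bool → List Bool
  | _, [] => []
  | v, x :: w => (x ^^ R.parity (v 0)) :: run (R.step v x) w

theorem run_zero (w : List Bool) : R.run (0 : Fin k → M) w = w := by
  induction w with
  | nil => rfl
  | cons x w ih => simp [run, R.parity_zero, R.step_zero, ih]

theorem run_add (u v : Fin k → M) (w : List Bool) : R.run (u + v) w = R.run u (R.run v w) := by
  induction w generalizing u v with
  | nil => rfl
  | cons x w ih =>
    simp only [run, Pi.add_apply, R.parity_add, R.step_add, ih]
    rw [Bool.xor_assoc, Bool.xor_comm (R.parity (u 0))]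

theorem parity_and_run_step {v : Fin k → M} (hv : ∀ w, R.run v w = w) :
    R.parity (v 0) = false ∧ ∀ w, R.run (R.step v false) w = w := by
  have hpar : R.parity (v 0) = false := by simpa [run] using hv [false]
  exact ⟨hpar, fun w => by simpa [run, hpar] using hv (false :: w)⟩

theorem apply_eq_zero_of_run_eq (s j : ℕ) (hj : j < k) (v : Fin k → M)
    (hs : R.size (v ⟨j, hj⟩) ≤ s) (hv : ∀ w, R.run v w = w) : v ⟨j, hj⟩ = 0 := by
  induction s using Nat.strong_induction_on generalizing j v with
  | _ s ihs =>
  induction j generalizing v with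
  | zero =>
    obtain ⟨hpar, hstep⟩ := R.parity_and_run_step hv
    by_contra hne
    have hd := R.descent _ hpar hne
    have hlast : R.step v false ⟨(-1 : Fin k), Fin.is_lt _⟩ = R.carry (v 0) false := by
      simp [step]
    refine hd.1 (hlast ▸ ihs _ (lt_of_lt_of_le hd.2 hs) _ (Fin.is_lt _) _ ?_ hstep)
    rw [hlast]
  | succ j ihj =>
    have hj' : (⟨j, by omega⟩ + 1 : Fin k) = ⟨j + 1, hj⟩ := by
      ext
      simp [Fin.val_add, Nat.mod_eq_of_lt hj]
    have hnext : R.step v false ⟨j, by omega⟩ = v ⟨j + 1, hj⟩ := by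
      rw [step, hj', Function.update_of_ne]
      simp [Fin.ext_iff]
    rw [← hnext] at hs ⊢
    exact ihj _ _ hs (R.parity_and_run_step hv).2

/-- The action of registers as a homomorphism to permutations of words. -/
def toPerm : Multiplicative (Fin k → M) →* Equiv.Perm (List Bool) where
  toFun v :=
    { toFun := R.run v.toAdd
      invFun := R.run (-v.toAdd)
      left_inv := fun w => by rw [← R.run_add, neg_add_cancel, R.run_zero]
      right_inv := fun w => by rw [← R.run_add, add_neg_cancel, R.run_zero] }
  map_one' := Equiv.ext fun w => R.run_zero w
  map_mul' u v := Equiv.ext fun w => R.run_add u.toAdd v.toAdd w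

theorem toPerm_injective : Function.Injective (R.toPerm (k := k)) := by
  rw [injective_iff_map_eq_one]
  intro v hv
  ext j
  exact R.apply_eq_zero_of_run_eq _ j j.2 v.toAdd le_rfl fun w => DFunLike.congr_fun hv w

/-- The register attached to a state: a unit in a single cell, or the zero register. -/
def stateVec (k : ℕ) {n : ℕ} (q : Fin n) : Fin k → M :=
  if h : (q : ℕ) < k then Pi.single ⟨q, h⟩ R.one else 0

theorem stateVec_castLE {k n : ℕ} (hk : k ≤ n) (j : Fin k) :
    R.stateVec k (Fin.castLE hk j) = Pi.single j R.one := by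
  simp [stateVec]

theorem exists_stateVec_eq_step {n : ℕ} (hk : k ≤ n)
    (hcarry : ∀ x, R.carry R.one x = R.one ∨ (R.carry R.one x = 0 ∧ k < n))
    (q : Fin n) (x : Bool) : ∃ q' : Fin n, R.stateVec k q' = R.step (R.stateVec k q) x := by
  by_cases h : (q : ℕ) < k
  · have hq : R.stateVec k q = Pi.single ⟨q, h⟩ R.one := by simp [stateVec, h]
    rw [hq]
    by_cases h0 : (⟨q, h⟩ : Fin k) = 0
    · rw [h0, R.step_single_zero]
      rcases hcarry x with h1 | ⟨h1, hlt⟩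
      · exact ⟨Fin.castLE hk (-1), by rw [R.stateVec_castLE, h1]⟩
      · exact ⟨⟨k, hlt⟩, by simp [stateVec, h1]⟩
    · exact ⟨Fin.castLE hk (⟨q, h⟩ - 1), by rw [R.stateVec_castLE, R.step_single h0]⟩
  · have hq : R.stateVec k q = 0 := by simp [stateVec, h]
    exact ⟨q, by rw [hq, R.step_zero]⟩

end CarryRule

/-- A subgroup of tree automorphisms is isomorphic to its group of permutations of words. -/
noncomputable def mulEquivMapSubtype (G : Subgroup ↥binTreeAut) :
    G ≃* G.map binTreeAut.subtype :=
  G.equivMapOfInjective _ binTreeAut.subtype_injective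

namespace TVAutomaton

theorem map_subtype_genGroup {Q : Type*} (A : TVAutomaton Q) (h : A.Invertible) :
    (A.genGroup h).map binTreeAut.subtype = Subgroup.closure (Set.range (A.toPerm h 0)) := by
  rw [genGroup, MonoidHom.map_closure, ← Set.range_comp]
  rfl

end TVAutomaton

theorem CarryRule.exists_mealy {M : Type*} [AddCommGroup M] (R : CarryRule M) {k n : ℕ}
    [NeZero k] (hk : k ≤ n)
    (hcarry : ∀ x, R.carry R.one x = R.one ∨ (R.carry R.one x = 0 ∧ k < n)) :
    ∃ (A : TVAutomaton (Fin n)) (h : A.Invertible), A.IsMealy ∧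
      Nonempty (A.genGroup h ≃* Multiplicative (Fin k → M)) := by
  choose φ hφ using R.exists_stateVec_eq_step hk hcarry
  let A : TVAutomaton (Fin n) :=
    ⟨fun _ => φ, fun _ q x => x ^^ R.parity (R.stateVec k q 0)⟩
  have hA : A.Invertible := fun i q =>
    Function.Involutive.bijective fun x => by simp [A]
  have hact : ∀ w i q, A.act i q w = R.run (R.stateVec k q) w := by
    intro w
    induction w with
    | nil => intro i q; rfl
    | cons x w ih =>
      intro i q
      rw [TVAutomaton.act, ih, CarryRule.run, ← hφ]
  have hperm : ∀ q, A.toPerm hA 0 q = R.toPerm (Multiplicative.ofAdd (R.stateVec k q)) :=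
    fun q => Equiv.ext fun w => hact w 0 q
  have hrange : (A.genGroup hA).map binTreeAut.subtype = (R.toPerm (k := k)).range := by
    rw [A.map_subtype_genGroup]
    apply le_antisymm
    · rw [Subgroup.closure_le]
      rintro _ ⟨q, rfl⟩
      exact ⟨_, (hperm q).symm⟩
    · rintro _ ⟨v, rfl⟩
      have hv : v = ∏ j, Multiplicative.ofAdd (Pi.single j (v.toAdd j) : Fin k → M) := by
        rw [← ofAdd_sum, Finset.univ_sum_single]; rfl
      rw [← Subgroup.mem_comap, hv]
      refine Subgroup.prod_mem _ fun j _ => ?_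
      obtain ⟨z, hz⟩ := R.exists_zsmul_one (v.toAdd j)
      rw [← hz, Pi.single_zsmul, ofAdd_zsmul]
      refine Subgroup.zpow_mem _ ?_ z
      rw [Subgroup.mem_comap, ← R.stateVec_castLE hk, ← hperm]
      exact Subgroup.subset_closure (Set.mem_range_self _)
  exact ⟨A, hA, fun i => ⟨rfl, rfl⟩, ⟨(mulEquivMapSubtype _).trans
    ((MulEquiv.subgroupCongr hrange).trans (MonoidHom.ofInjective R.toPerm_injective).symm)⟩⟩

theorem exists_mealy_subsingleton (n : ℕ) :
    ∃ (A : TVAutomaton (Fin n)) (h : A.Invertible), A.IsMealy ∧ Subsingleton (A.genGroup h) := by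
  let A : TVAutomaton (Fin n) := ⟨fun _ q _ => q, fun _ _ x => x⟩
  have hA : A.Invertible := fun i q => Function.bijective_id
  have hact : ∀ w i q, A.act i q w = w := by
    intro w
    induction w with
    | nil => intro i q; rfl
    | cons x w ih => intro i q; rw [TVAutomaton.act, ih]
  refine ⟨A, hA, fun i => ⟨rfl, rfl⟩, ?_⟩
  have hbot : A.genGroup hA = ⊥ := by
    rw [TVAutomaton.genGroup, Subgroup.closure_eq_bot_iff]
    rintro _ ⟨q, rfl⟩
    exact Subtype.ext (Equiv.ext fun w => hact w 0 q)
  rw [hbot]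
  infer_instance

namespace TVAutomaton

variable {Q : Type*} (A : TVAutomaton Q) (h : A.Invertible)

theorem IsMealy.act_eq {A : TVAutomaton Q} (hA : A.IsMealy) (w : List Bool) (i : ℕ) (q : Q) :
    A.act i q w = A.act 0 q w := by
  induction w generalizing i q with
  | nil => rfl
  | cons x w ih => rw [act, act, (hA i).1, (hA i).2, ih (i + 1), ih (0 + 1)]

/-- The transformation of a state as an element of the group of the automaton. -/
noncomputable def gen (q : Q) : A.genGroup h :=
  ⟨A.toAut h 0 q, Subgroup.subset_closure ⟨q, rfl⟩⟩

theorem closure_range_gen : Subgroup.closure (Set.range (A.gen h)) = ⊤ := by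
  apply Subgroup.map_injective (A.genGroup h).subtype_injective
  rw [MonoidHom.map_closure, ← Set.range_comp, ← MonoidHom.range_eq_map, Subgroup.range_subtype]
  rfl

/-- The action of the group of an automaton on binary words. -/
noncomputable def actionHom : A.genGroup h →* Equiv.Perm (List Bool) :=
  binTreeAut.subtype.comp (A.genGroup h).subtype

theorem actionHom_injective : Function.Injective (A.actionHom h) :=
  binTreeAut.subtype_injective.comp (A.genGroup h).subtype_injective

theorem actionHom_gen_cons (hA : A.IsMealy) (q : Q) (x : Bool) (w : List Bool) :
    A.actionHom h (A.gen h q) (x :: w) =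
      (x ^^ A.psi 0 q false) :: A.actionHom h (A.gen h (A.phi 0 q x)) w := by
  have hψ : A.psi 0 q x = (x ^^ A.psi 0 q false) := by
    have hne : A.psi 0 q true ≠ A.psi 0 q false := fun hc => by simpa using (h 0 q).1 hc
    cases x
    · simp
    · simpa using Bool.eq_not_of_ne hne
  change A.act 0 q (x :: w) = _ :: A.act 0 _ w
  rw [act, hA.act_eq w, hψ]

theorem exists_sections (hA : A.IsMealy) (g : A.genGroup h) :
    ∃ (a : Bool) (s : Bool → A.genGroup h),
      ∀ x w, A.actionHom h g (x :: w) = (x ^^ a) :: A.actionHom h (s x) w := by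
  have hg : g ∈ Subgroup.closure (Set.range (A.gen h)) := by
    rw [A.closure_range_gen]; trivial
  induction hg using Subgroup.closure_induction with
  | mem g hg =>
    obtain ⟨q, rfl⟩ := hg
    exact ⟨_, _, A.actionHom_gen_cons h hA q⟩
  | one => exact ⟨false, fun _ => 1, fun x w => by simp⟩
  | mul g₁ g₂ _ _ ih₁ ih₂ =>
    obtain ⟨a, s, hs⟩ := ih₁
    obtain ⟨b, t, ht⟩ := ih₂
    refine ⟨a ^^ b, fun x => s (x ^^ b) * t x, fun x w => ?_⟩
    rw [map_mul, Equiv.Perm.mul_apply, ht, hs, map_mul, Equiv.Perm.mul_apply, Bool.xor_assoc,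
      Bool.xor_comm b]
  | inv g _ ih =>
    obtain ⟨a, s, hs⟩ := ih
    refine ⟨a, fun x => (s (x ^^ a))⁻¹, fun x w => ?_⟩
    rw [map_inv, Equiv.Perm.inv_eq_iff_eq, hs, map_inv]
    simp

theorem nonempty_mulEquiv {n : ℕ} (hn : 1 ≤ n) (A : TVAutomaton (Fin n)) (h : A.Invertible)
    (hA : A.IsMealy) (hcomm : ∀ a b : A.genGroup h, a * b = b * a) :
    (∃ k ≤ n, Nonempty (A.genGroup h ≃* Multiplicative (Fin k → ZMod 2))) ∨
      ∃ k < n, Nonempty (A.genGroup h ≃* Multiplicative (Fin k → ℤ)) := by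
  choose a s hs using A.exists_sections h hA
  let _ : CommGroup (A.genGroup h) :=
    { (inferInstance : Group (A.genGroup h)) with mul_comm := hcomm }
  let S : SelfSimilarAction (A.genGroup h) :=
    { toPerm := A.actionHom h
      injective := A.actionHom_injective h
      active := a
      sec := s
      apply_nil := fun g => g.1.2.1
      apply_cons := hs }
  exact S.nonempty_mulEquiv hn (A.gen h) (A.phi 0)
    (fun q => (S.active_and_sec_eq (A.actionHom_gen_cons h hA q)).2) (A.closure_range_gen h)

end TVAutomaton

/-- The `i`-th isomorphism type: first the nontrivial elementary abelian `2`-groups of rank at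
most `n`, then the free abelian groups of rank less than `n`. -/
def HasIsoType (n i : ℕ) (G : Type*) [Group G] : Prop :=
  (i < n ∧ Nonempty (G ≃* Multiplicative (Fin (i + 1) → ZMod 2))) ∨
    (n ≤ i ∧ Nonempty (G ≃* Multiplicative (Fin (i - n) → ℤ)))

theorem HasIsoType.mul_comm {n i : ℕ} {G : Type*} [Group G] (hG : HasIsoType n i G) (a b : G) :
    a * b = b * a := by
  rcases hG with ⟨-, ⟨e⟩⟩ | ⟨-, ⟨e⟩⟩ <;>
    exact e.injective (by rw [map_mul, map_mul, _root_.mul_comm])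

theorem HasIsoType.of_mulEquiv {n i : ℕ} {G H : Type*} [Group G] [Group H] (e : G ≃* H)
    (hG : HasIsoType n i G) : HasIsoType n i H := by
  rcases hG with ⟨hi, ⟨f⟩⟩ | ⟨hi, ⟨f⟩⟩
  exacts [.inl ⟨hi, ⟨e.symm.trans f⟩⟩, .inr ⟨hi, ⟨e.symm.trans f⟩⟩]

theorem isEmpty_mulEquiv_zmod_two_int (k l : ℕ) :
    IsEmpty (Multiplicative (Fin (k + 1) → ZMod 2) ≃* Multiplicative (Fin l → ℤ)) := by
  refine ⟨fun e => ?_⟩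
  have htriv : ∀ v : Multiplicative (Fin l → ℤ), v = 1 := by
    intro v
    have hsq : e.symm v * e.symm v = 1 := by
      ext j
      exact CharTwo.add_self_eq_zero _
    have hv : v * v = 1 := by simpa using congrArg e hsq
    ext j
    have hj : v.toAdd j + v.toAdd j = 0 := congrFun hv j
    change v.toAdd j = 0
    omega
  have h1 : Multiplicative.ofAdd (fun _ : Fin (k + 1) => (1 : ZMod 2)) = 1 :=
    e.injective ((htriv _).trans (htriv _).symm)
  exact one_ne_zero (congrFun h1 0)

theorem HasIsoType.index_unique {n i j : ℕ} {G : Type*} [Group G] (hi : HasIsoType n i G)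
    (hj : HasIsoType n j G) : i = j := by
  rcases hi with ⟨hi, ⟨e⟩⟩ | ⟨hi, ⟨e⟩⟩ <;> rcases hj with ⟨hj, ⟨f⟩⟩ | ⟨hj, ⟨f⟩⟩
  · have := Nat.card_congr (e.symm.trans f).toEquiv
    simpa using this
  · exact ((isEmpty_mulEquiv_zmod_two_int _ _).false (e.symm.trans f)).elim
  · exact ((isEmpty_mulEquiv_zmod_two_int _ _).false (f.symm.trans e)).elim
  · have h : i - n = j - n := by
      simpa using LinearEquiv.finrank_eq
        (AddEquiv.toMultiplicative.symm (e.symm.trans f)).toIntLinearEquiv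
    omega

theorem exists_mealy_hasIsoType {n i : ℕ} (hi : i < 2 * n) :
    ∃ (A : TVAutomaton (Fin n)) (h : A.Invertible), A.IsMealy ∧ HasIsoType n i (A.genGroup h) := by
  rcases lt_or_ge i n with hin | hin
  · obtain ⟨A, h, hA, e⟩ := zmodTwoCarryRule.exists_mealy (k := i + 1) (n := n) hin
      fun x => .inl rfl
    exact ⟨A, h, hA, .inl ⟨hin, e⟩⟩
  · rcases hin.eq_or_lt with rfl | hlt
    · obtain ⟨A, h, hA, hs⟩ := exists_mealy_subsingleton n
      refine ⟨A, h, hA, .inr ⟨le_rfl, ?_⟩⟩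
      rw [Nat.sub_self]
      have : Unique (A.genGroup h) := uniqueOfSubsingleton 1
      exact ⟨MulEquiv.ofUnique⟩
    · have : NeZero (i - n) := ⟨by omega⟩
      obtain ⟨A, h, hA, e⟩ := intCarryRule.exists_mealy (k := i - n) (n := n) (by omega)
        fun x => by cases x; exacts [.inr ⟨rfl, by omega⟩, .inl rfl]
      exact ⟨A, h, hA, .inr ⟨hin, e⟩⟩

/-- For every `n ≥ 1` there are, up to isomorphism, exactly `2 * n` abelian
groups generated by an invertible `n`-state Mealy automaton over the binary alphabet. -/
theorem mealy_abelian_count (n : ℕ) (hn : 1 ≤ n) :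
    ∃ Gs : Fin (2 * n) → Subgroup ↥binTreeAut,
      (∀ i, ∃ (A : TVAutomaton (Fin n)) (h : A.Invertible),
          A.IsMealy ∧ Gs i = A.genGroup h ∧ ∀ a b : (Gs i), a * b = b * a) ∧
      (∀ i j, i ≠ j → IsEmpty ((Gs i) ≃* (Gs j))) ∧
      (∀ (A : TVAutomaton (Fin n)) (h : A.Invertible), A.IsMealy →
        (∀ a b : (A.genGroup h), a * b = b * a) →
          ∃ i, Nonempty ((A.genGroup h) ≃* (Gs i))) := by
  choose A h hA hiso using fun i : Fin (2 * n) => exists_mealy_hasIsoType i.2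
  refine ⟨fun i => (A i).genGroup (h i), fun i => ⟨A i, h i, hA i, rfl, (hiso i).mul_comm⟩,
    fun i j hij => ⟨fun e => hij (Fin.ext (((hiso i).of_mulEquiv e).index_unique (hiso j)))⟩,
    fun B hB hM hcomm => ?_⟩
  have key : ∀ i : ℕ, i < 2 * n → HasIsoType n i (B.genGroup hB) →
      ∃ i, Nonempty (B.genGroup hB ≃* (A i).genGroup (h i)) := by
    intro i hi hBi
    refine ⟨⟨i, hi⟩, ?_⟩
    have hAi : HasIsoType n i _ := hiso ⟨i, hi⟩
    rcases hBi with ⟨_, ⟨e⟩⟩ | ⟨_, ⟨e⟩⟩ <;> rcases hAi with ⟨_, ⟨f⟩⟩ | ⟨_, ⟨f⟩⟩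
    · exact ⟨e.trans f.symm⟩
    · omega
    · omega
    · exact ⟨e.trans f.symm⟩
  rcases B.nonempty_mulEquiv hn hB hM hcomm with ⟨k, hk, ⟨e⟩⟩ | ⟨k, hk, e⟩
  · rcases k with _ | k
    · exact key n (by omega) (.inr ⟨le_rfl, by
        rw [Nat.sub_self]
        exact ⟨e.trans MulEquiv.ofUnique⟩⟩)
    · exact key k (by omega) (.inl ⟨hk, ⟨e⟩⟩)
  · exact key (n + k) (by omega) (.inr ⟨by omega, by rwa [Nat.add_sub_cancel_left]⟩)
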